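/- Let G be a finite group, let τ and α be normalized unitary 2-cocycles on G, and let V be a unitary α-projective representation of G of degree d. Define the invertible operator S := Σ_{g∈G} |g⟩⟨g| ⊗ V(g) on ℂG ⊗ ℂ^d, and define the 2-cocycle (τᾱ)(g,h) := τ(g,h)/α(g,h). Then for all g ∈ G: S·(L^τ(g) ⊗ I_d)·S⁻¹ = L^{τᾱ}(g) ⊗ V(g). -/

import Mathlib

open Matrix Kronecker

/-- The left regular `τ`-projective representation of a finite group `G`, acting on `ℂG`:
`(L^τ g) h' h = τ g h` if `h' = g * h` and `0` otherwise. -/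
def Lreg {G : Type*} [Group G] [DecidableEq G] (τ : G → G → ℂ) (g : G) :
    Matrix G G ℂ :=
  fun h' h => if h' = g * h then τ g h else 0

/-- Entries of the block-diagonal matrix `Σ_x |x⟩⟨x| ⊗ V x`. -/
theorem sum_single_kronecker_apply {ι n R : Type*} [Fintype ι] [DecidableEq ι] [CommSemiring R]
    (V : ι → Matrix n n R) (a b : ι) (i j : n) :
    (∑ x, Matrix.single x x (1 : R) ⊗ₖ V x) (a, i) (b, j) = if a = b then V a i j else 0 := by
  simp only [Matrix.sum_apply, kroneckerMap_apply, single_apply, ite_mul, one_mul, zero_mul]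
  split_ifs with h
  · subst h
    simp
  · refine Finset.sum_eq_zero fun x _ => if_neg ?_
    rintro ⟨rfl, rfl⟩
    exact h rfl

theorem sum_single_kronecker_mul {ι n R : Type*} [Fintype ι] [DecidableEq ι] [Fintype n]
    [CommSemiring R] (V W : ι → Matrix n n R) :
    (∑ x, Matrix.single x x (1 : R) ⊗ₖ V x) * (∑ x, Matrix.single x x (1 : R) ⊗ₖ W x)
      = ∑ x, Matrix.single x x (1 : R) ⊗ₖ (V x * W x) := by
  ext ⟨a, i⟩ ⟨b, j⟩
  simp only [mul_apply, Fintype.sum_prod_type, sum_single_kronecker_apply]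
  by_cases h : a = b <;> simp [h]

theorem sum_single_kronecker_one {ι n R : Type*} [Fintype ι] [DecidableEq ι] [DecidableEq n]
    [CommSemiring R] :
    ∑ x : ι, Matrix.single x x (1 : R) ⊗ₖ (1 : Matrix n n R) = 1 := by
  ext ⟨a, i⟩ ⟨b, j⟩
  rw [sum_single_kronecker_apply]
  by_cases h : a = b <;> simp [h, one_apply]

/-- The operator `Σ_x |x⟩⟨x| ⊗ V x` intertwines `L^τ g ⊗ 1` and `L^{τ/α} g ⊗ V g`. -/
theorem sum_single_kronecker_mul_Lreg {G n : Type*} [Group G] [Fintype G] [DecidableEq G]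
    [Fintype n] [DecidableEq n] {τ α : G → G → ℂ} (hα : ∀ g h, α g h ≠ 0)
    {V : G → Matrix n n ℂ} (hproj : ∀ g h, V g * V h = α g h • V (g * h)) (g : G) :
    (∑ x, Matrix.single x x (1 : ℂ) ⊗ₖ V x) * (Lreg τ g ⊗ₖ (1 : Matrix n n ℂ))
      = (Lreg (fun a b => τ a b / α a b) g ⊗ₖ V g)
          * (∑ x, Matrix.single x x (1 : ℂ) ⊗ₖ V x) := by
  ext ⟨a, i⟩ ⟨b, j⟩
  simp only [mul_apply, Fintype.sum_prod_type, sum_single_kronecker_apply, kroneckerMap_apply,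
    Lreg]
  by_cases h : a = g * b
  · subst h
    have hV : ∑ k, V g i k * V b k j = α g b * V (g * b) i j := by
      simpa [mul_apply] using congrFun (congrFun (hproj g b) i) j
    conv_rhs => rw [Finset.sum_comm]
    simp only [ite_mul, zero_mul, mul_ite, mul_zero, Finset.sum_ite_eq',
      Finset.mem_univ, if_true, one_apply, mul_one, mul_assoc, ← Finset.mul_sum, hV]
    field_simp [hα g b]
  · simp [h]

/-- For a finite group `G`, normalized unitary 2-cocycles `τ` and `α` on `G`, and
a unitary `α`-projective representation `V` of degree `d`, the invertible operator
`S = Σ_g |g⟩⟨g| ⊗ V(g)` satisfies `S·(L^τ(g) ⊗ I_d)·S⁻¹ = L^{τᾱ}(g) ⊗ V(g)` for all `g`,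
where `(τᾱ)(g,h) = τ(g,h)/α(g,h)`. -/
theorem conjugation_of_left_regular_by_controlled_V
    {G : Type*} [Group G] [Fintype G] [DecidableEq G]
    (τ α : G → G → ℂ)
    (hτunit : ∀ g h, ‖τ g h‖ = 1)
    (hτnorm : ∀ g, τ g 1 = 1 ∧ τ 1 g = 1)
    (hτcoc : ∀ g h k, τ g h * τ (g * h) k = τ g (h * k) * τ h k)
    (hαunit : ∀ g h, ‖α g h‖ = 1)
    (hαnorm : ∀ g, α g 1 = 1 ∧ α 1 g = 1)
    (hαcoc : ∀ g h k, α g h * α (g * h) k = α g (h * k) * α h k)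
    (d : ℕ)
    (V : G → Matrix (Fin d) (Fin d) ℂ)
    (hU : ∀ g, V g * (V g)ᴴ = 1)
    (hproj : ∀ g h, V g * V h = α g h • V (g * h)) :
    IsUnit (∑ g : G, Matrix.single g g (1 : ℂ) ⊗ₖ V g) ∧
    ∀ g : G,
      (∑ x : G, Matrix.single x x (1 : ℂ) ⊗ₖ V x)
          * (Lreg τ g ⊗ₖ (1 : Matrix (Fin d) (Fin d) ℂ))
          * (∑ x : G, Matrix.single x x (1 : ℂ) ⊗ₖ V x)⁻¹
        = Lreg (fun a b => τ a b / α a b) g ⊗ₖ V g := by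
  have hα (g h : G) : α g h ≠ 0 := norm_ne_zero_iff.mp (by simp [hαunit])
  have hS : IsUnit (∑ g : G, Matrix.single g g (1 : ℂ) ⊗ₖ V g) := by
    refine .of_mul_eq_one (∑ g : G, Matrix.single g g (1 : ℂ) ⊗ₖ (V g)ᴴ) ?_
    simp only [sum_single_kronecker_mul, hU, sum_single_kronecker_one]
  refine ⟨hS, fun g => ?_⟩
  rw [sum_single_kronecker_mul_Lreg hα hproj,
    Matrix.mul_nonsing_inv_cancel_right _ _ ((isUnit_iff_isUnit_det _).mp hS)]
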